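/- arXiv:math/0209148 — 4 statements merged into one kernel-verified Lean document; each statement's English description precedes it below -/
import Mathlib

section
/- Let (V₁, ω₁), (V₂, ω₂), (V₃, ω₃) be symplectic vector spaces. Let G₁ be a linear canonical relation between V₁ and V₂ and let G₂ be a linear canonical relation between V₂ and V₃. Assume the transversality condition: G₁ × G₂ + {(v₁, w, w, v₃) : v₁ ∈ V₁, w ∈ V₂, v₃ ∈ V₃} = V₁ × V₂ × V₂ × V₃ (as subspaces of V₁ × V₂ × V₂ × V₃). Then the composition G₁ ∘ G₂ = {(x, z) ∈ V₁ × V₃ : there exists y ∈ V₂ with (x, y) ∈ G₁ and (y, z) ∈ G₂} is a linear canonical relation between V₁ and V₃, i.e. a Lagrangian subspace of (V₁ × V₃, ω₁ ⊖ ω₃). -/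
open LinearMap (BilinForm)

/-- A submodule `L` is Lagrangian for the (bilinear) pairing `ω` if it equals its own
`ω`-orthogonal complement. -/
def IsLagrangian {V : Type*} [AddCommGroup V] [Module ℝ V]
    (ω : V → V → ℝ) (L : Submodule ℝ V) : Prop :=
  ∀ v : V, v ∈ L ↔ ∀ w ∈ L, ω v w = 0

/-- A set `L` is a Lagrangian subspace for the pairing `ω` if it is a linear subspace and
equals its own `ω`-orthogonal complement. -/
def IsLagrangianSet {V : Type*} [AddCommGroup V] [Module ℝ V]
    (ω : V → V → ℝ) (L : Set V) : Prop :=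
  (∃ p : Submodule ℝ V, (p : Set V) = L) ∧ ∀ v : V, v ∈ L ↔ ∀ w ∈ L, ω v w = 0

/-- The difference form `ω₁ ⊖ ω₂` on `V₁ × V₂`. -/
def diffForm {V₁ V₂ : Type*} (ω₁ : V₁ → V₁ → ℝ) (ω₂ : V₂ → V₂ → ℝ) :
    V₁ × V₂ → V₁ × V₂ → ℝ :=
  fun p q => ω₁ p.1 q.1 - ω₂ p.2 q.2

/-- A linear functional vanishing on the kernel of a linear map `T` into a space with a
nondegenerate bilinear form `ω` is of the form `u ↦ ω y (T u)`. -/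
theorem exists_eq_apply_of_ker_le_ker {U V : Type*} [AddCommGroup U] [Module ℝ U]
    [AddCommGroup V] [Module ℝ V] [FiniteDimensional ℝ V]
    {ω : BilinForm ℝ V} (hω : ω.Nondegenerate) (T : U →ₗ[ℝ] V) (ψ : U →ₗ[ℝ] ℝ)
    (h : LinearMap.ker T ≤ LinearMap.ker ψ) : ∃ y : V, ∀ u, ω y (T u) = ψ u := by
  have hψ : ψ ∈ LinearMap.range T.dualMap := by
    rw [LinearMap.range_dualMap_eq_dualAnnihilator_ker, Submodule.mem_dualAnnihilator]
    exact fun u hu => h hu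
  obtain ⟨φ, rfl⟩ := hψ
  obtain ⟨y, rfl⟩ := (ω.toDual hω).surjective φ
  exact ⟨y, fun u => rfl⟩

/-- The composition of two linear relations, as a subspace. -/
def relationComp {V₁ V₂ V₃ : Type*} [AddCommGroup V₁] [Module ℝ V₁] [AddCommGroup V₂]
    [Module ℝ V₂] [AddCommGroup V₃] [Module ℝ V₃]
    (G₁ : Submodule ℝ (V₁ × V₂)) (G₂ : Submodule ℝ (V₂ × V₃)) : Submodule ℝ (V₁ × V₃) where
  carrier := {p | ∃ y : V₂, (p.1, y) ∈ G₁ ∧ (y, p.2) ∈ G₂}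
  zero_mem' := ⟨0, G₁.zero_mem, G₂.zero_mem⟩
  add_mem' := by
    rintro p q ⟨y, hy₁, hy₂⟩ ⟨y', hy₁', hy₂'⟩
    exact ⟨y + y', G₁.add_mem hy₁ hy₁', G₂.add_mem hy₂ hy₂'⟩
  smul_mem' := by
    rintro c p ⟨y, hy₁, hy₂⟩
    exact ⟨c • y, G₁.smul_mem c hy₁, G₂.smul_mem c hy₂⟩

/-- Hörmander's composition theorem for linear canonical relations: if `G₁` is a linear
canonical relation between the symplectic vector spaces `(V₁, ω₁)` and `(V₂, ω₂)`, `G₂` is a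
linear canonical relation between `(V₂, ω₂)` and `(V₃, ω₃)`, and `G₁ × G₂` is transverse to
the partial diagonal `V₁ × Δ(V₂) × V₃`, then the composition `G₁ ∘ G₂` is a linear canonical
relation between `(V₁, ω₁)` and `(V₃, ω₃)`. -/
theorem hormander_composition_of_linear_canonical_relations
    {V₁ V₂ V₃ : Type*}
    [AddCommGroup V₁] [Module ℝ V₁] [FiniteDimensional ℝ V₁]
    [AddCommGroup V₂] [Module ℝ V₂] [FiniteDimensional ℝ V₂]
    [AddCommGroup V₃] [Module ℝ V₃] [FiniteDimensional ℝ V₃]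
    (ω₁ : BilinForm ℝ V₁) (ω₂ : BilinForm ℝ V₂) (ω₃ : BilinForm ℝ V₃)
    (h₁alt : ω₁.IsAlt) (h₁nd : ω₁.Nondegenerate)
    (h₂alt : ω₂.IsAlt) (h₂nd : ω₂.Nondegenerate)
    (h₃alt : ω₃.IsAlt) (h₃nd : ω₃.Nondegenerate)
    (G₁ : Submodule ℝ (V₁ × V₂)) (G₂ : Submodule ℝ (V₂ × V₃))
    (hG₁ : IsLagrangian (diffForm (fun x y => ω₁ x y) (fun x y => ω₂ x y)) G₁)
    (hG₂ : IsLagrangian (diffForm (fun x y => ω₂ x y) (fun x y => ω₃ x y)) G₂)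
    (htrans : ∀ z : (V₁ × V₂) × (V₂ × V₃),
      ∃ g₁ ∈ G₁, ∃ g₂ ∈ G₂, ∃ (v₁ : V₁) (w : V₂) (v₃ : V₃),
        z = (g₁, g₂) + ((v₁, w), (w, v₃))) :
    IsLagrangianSet (diffForm (fun x y => ω₁ x y) (fun x y => ω₃ x y))
      {p : V₁ × V₃ | ∃ y : V₂, (p.1, y) ∈ G₁ ∧ (y, p.2) ∈ G₂} := by
  refine ⟨⟨relationComp G₁ G₂, rfl⟩, ?_⟩
  rintro ⟨x, z⟩
  constructor
  · rintro ⟨y, hy₁, hy₂⟩ ⟨x', z'⟩ ⟨y', hy₁', hy₂'⟩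
    have e₁ := (hG₁ _).1 hy₁ _ hy₁'
    have e₂ := (hG₂ _).1 hy₂ _ hy₂'
    simp only [diffForm] at e₁ e₂ ⊢
    linarith
  · intro h
    let p₁ : G₁ × G₂ →ₗ[ℝ] V₁ × V₂ := G₁.subtype ∘ₗ LinearMap.fst ℝ G₁ G₂
    let p₂ : G₁ × G₂ →ₗ[ℝ] V₂ × V₃ := G₂.subtype ∘ₗ LinearMap.snd ℝ G₁ G₂
    obtain ⟨y, hy⟩ := exists_eq_apply_of_ker_le_ker h₂nd
      (LinearMap.snd ℝ V₁ V₂ ∘ₗ p₁ - LinearMap.fst ℝ V₂ V₃ ∘ₗ p₂)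
      (ω₁ x ∘ₗ LinearMap.fst ℝ V₁ V₂ ∘ₗ p₁ - ω₃ z ∘ₗ LinearMap.snd ℝ V₂ V₃ ∘ₗ p₂) (by
        rintro ⟨⟨⟨x', y₁⟩, hg₁⟩, ⟨⟨y₂, z'⟩, hg₂⟩⟩ hu
        obtain rfl : y₁ = y₂ := sub_eq_zero.1 hu
        exact h (x', z') ⟨y₁, hg₁, hg₂⟩)
    refine ⟨y, (hG₁ _).2 fun g hg => ?_, (hG₂ _).2 fun g hg => ?_⟩
    · have e := hy (⟨g, hg⟩, 0)
      simp [p₁, p₂] at e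
      simp [diffForm, e]
    · have e := hy (0, ⟨g, hg⟩)
      simp [p₁, p₂] at e
      simp [diffForm, e]
end

section
/- Let (V₁, ω₁) and (V₂, ω₂) be symplectic vector spaces. Let G₁ be a linear canonical relation between V₁ and V₂ on which the projection π₂ : V₁ × V₂ → V₂ is injective, and let G₂ be a Lagrangian subspace of (V₂, ω₂). If π₂(G₁) + G₂ = V₂, then the set {x ∈ V₁ : there exists y ∈ G₂ with (x, y) ∈ G₁} is a Lagrangian subspace of (V₁, ω₁). -/
open LinearMap (BilinForm)

/-- A functional on a product of domains that vanishes on the pairs with cancelling images is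
induced by a functional on the common codomain. -/
theorem exists_dual_of_ker_coprod {K M N V : Type*} [Field K]
    [AddCommGroup M] [Module K M] [AddCommGroup N] [Module K N] [AddCommGroup V] [Module K V]
    (f : M →ₗ[K] V) (g : N →ₗ[K] V) (φ : M →ₗ[K] K)
    (h : ∀ m n, f m + g n = 0 → φ m = 0) :
    ∃ ψ : Module.Dual K V, (∀ m, ψ (f m) = φ m) ∧ ∀ n, ψ (g n) = 0 := by
  have hmem : φ.comp (LinearMap.fst K M N) ∈ (f.coprod g).dualMap.range := by
    rw [LinearMap.range_dualMap_eq_dualAnnihilator_ker, Submodule.mem_dualAnnihilator]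
    rintro ⟨m, n⟩ hmn
    exact h m n (by simpa using hmn)
  obtain ⟨ψ, hψ⟩ := hmem
  refine ⟨ψ, fun m => ?_, fun n => ?_⟩
  · simpa using LinearMap.congr_fun hψ (m, 0)
  · simpa using LinearMap.congr_fun hψ (0, n)

/-- Pulling back a Lagrangian subspace through a linear canonical relation: if `G₁` is a
linear canonical relation between `(V₁, ω₁)` and `(V₂, ω₂)` on which the projection to `V₂`
is injective, `G₂ ⊆ V₂` is Lagrangian, and `π₂(G₁) + G₂ = V₂`, then
`{x ∈ V₁ : ∃ y ∈ G₂, (x, y) ∈ G₁}` is a Lagrangian subspace of `(V₁, ω₁)`. -/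
theorem pullback_lagrangian_through_canonical_relation
    {V₁ V₂ : Type*}
    [AddCommGroup V₁] [Module ℝ V₁] [FiniteDimensional ℝ V₁]
    [AddCommGroup V₂] [Module ℝ V₂] [FiniteDimensional ℝ V₂]
    (ω₁ : BilinForm ℝ V₁) (ω₂ : BilinForm ℝ V₂)
    (h₁alt : ω₁.IsAlt) (h₁nd : ω₁.Nondegenerate)
    (h₂alt : ω₂.IsAlt) (h₂nd : ω₂.Nondegenerate)
    (G₁ : Submodule ℝ (V₁ × V₂)) (G₂ : Submodule ℝ V₂)
    (hG₁ : IsLagrangian (diffForm (fun x y => ω₁ x y) (fun x y => ω₂ x y)) G₁)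
    (hinj : ∀ p ∈ G₁, ∀ q ∈ G₁, p.2 = q.2 → p = q)
    (hG₂ : IsLagrangian (fun x y => ω₂ x y) G₂)
    (htrans : Submodule.map (LinearMap.snd ℝ V₁ V₂) G₁ ⊔ G₂ = ⊤) :
    IsLagrangianSet (fun x y => ω₁ x y)
      {x : V₁ | ∃ y ∈ G₂, (x, y) ∈ G₁} := by
  refine ⟨⟨(G₁ ⊓ G₂.comap (LinearMap.snd ℝ V₁ V₂)).map (LinearMap.fst ℝ V₁ V₂), ?_⟩,
    fun v => ⟨?_, fun hv => ?_⟩⟩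
  · ext x
    simp [and_comm]
  · rintro ⟨y, hy, hxy⟩ w ⟨z, hz, hwz⟩
    have h := (hG₁ _).1 hxy _ hwz
    simpa [diffForm, (hG₂ y).1 hy z hz] using h
  · obtain ⟨ψ, hψ₁, hψ₂⟩ := exists_dual_of_ker_coprod
      ((LinearMap.snd ℝ V₁ V₂).comp G₁.subtype) G₂.subtype
      ((ω₁ v).comp ((LinearMap.fst ℝ V₁ V₂).comp G₁.subtype))
      (fun m n hmn => hv _ ⟨m.1.2, by
        rw [show m.1.2 = -(n : V₂) from eq_neg_of_add_eq_zero_left hmn]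
        exact G₂.neg_mem n.2, m.2⟩)
    obtain ⟨y, rfl⟩ := (ω₂.toDual h₂nd).surjective ψ
    refine ⟨y, (hG₂ y).2 fun w hw => hψ₂ ⟨w, hw⟩, (hG₁ _).2 fun p hp => ?_⟩
    exact sub_eq_zero.2 (hψ₁ ⟨p, hp⟩).symm
end

section
/- Let L₁, …, L_l be Lagrangian subspaces of ℝⁿ × ℝⁿ with the standard symplectic form ω₀((x, ξ), (x', ξ')) = ⟨ξ, x'⟩ − ⟨ξ', x⟩. Let D = {((x, ξ₁), (x, ξ₂), …, (x, ξ_l)) : x ∈ ℝⁿ, ξ₁, …, ξ_l ∈ ℝⁿ} ⊆ (ℝⁿ × ℝⁿ)ˡ be the conormal-to-the-diagonal subspace. If L₁ × ⋯ × L_l + D = (ℝⁿ × ℝⁿ)ˡ, then the subspace L = {(x, ξ₁ + ⋯ + ξ_l) : (x, ξᵢ) ∈ Lᵢ for all 1 ≤ i ≤ l} is a Lagrangian subspace of (ℝⁿ × ℝⁿ, ω₀). -/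
/-- The standard symplectic form `ω₀((x, ξ), (x', ξ')) = ⟨ξ, x'⟩ − ⟨ξ', x⟩` on
`ℝⁿ × ℝⁿ`. -/
def stdSymplecticForm {n : ℕ} (p q : (Fin n → ℝ) × (Fin n → ℝ)) : ℝ :=
  (∑ i, p.2 i * q.1 i) - (∑ i, q.2 i * p.1 i)

/-- A linear functional on the source of a surjective linear map descends to the target as soon
as it vanishes on the kernel. -/
lemma exists_functional_comp_eq {M N : Type*} [AddCommGroup M] [Module ℝ M] [AddCommGroup N]
    [Module ℝ N] (S : M →ₗ[ℝ] N) (hS : Function.Surjective S) (g : M →ₗ[ℝ] ℝ)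
    (hg : ∀ u, S u = 0 → g u = 0) : ∃ f : N →ₗ[ℝ] ℝ, ∀ u, f (S u) = g u := by
  obtain ⟨T, hT⟩ := S.exists_rightInverse_of_surjective (LinearMap.range_eq_top.2 hS)
  refine ⟨g ∘ₗ T, fun u => ?_⟩
  have hTS : S (T (S u)) = S u := LinearMap.congr_fun hT (S u)
  have h := hg (T (S u) - u) (by rw [map_sub, hTS, sub_self])
  rw [map_sub, sub_eq_zero] at h
  exact h

/-- The linear map `(x, ξ) ↦ ((x, ξ₁), …, (x, ξ_l))` parametrizing the conormal space of the
diagonal. -/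
def conormalDiagonal (n l : ℕ) :
    (Fin n → ℝ) × (Fin l → Fin n → ℝ) →ₗ[ℝ] (Fin l → (Fin n → ℝ) × (Fin n → ℝ)) where
  toFun u i := (u.1, u.2 i)
  map_add' _ _ := rfl
  map_smul' _ _ := rfl

/-- The linear functional `(x, ξ) ↦ ⟨η, x⟩ - ⟨∑ ξᵢ, y⟩`, the pairing of `(y, η)` with
`(x, ∑ ξᵢ)`. -/
def conflictPairing (n l : ℕ) (v : (Fin n → ℝ) × (Fin n → ℝ)) :
    (Fin n → ℝ) × (Fin l → Fin n → ℝ) →ₗ[ℝ] ℝ where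
  toFun u := stdSymplecticForm v (u.1, ∑ i, u.2 i)
  map_add' a b := by
    simp only [stdSymplecticForm, Prod.fst_add, Prod.snd_add, Pi.add_apply, mul_add, add_mul,
      Finset.sum_add_distrib]
    ring
  map_smul' c a := by
    simp only [stdSymplecticForm, Prod.smul_fst, Prod.smul_snd, Pi.smul_apply, smul_eq_mul,
      ← Finset.smul_sum, RingHom.id_apply, mul_sub, Finset.mul_sum]
    congr 1 <;> exact Finset.sum_congr rfl fun _ _ => by ring

/-- The symplectic form on points over common base points is additive in the fibre variables. -/
lemma stdSymplecticForm_sum {n l : ℕ} (x y : Fin n → ℝ) (ξ ζ : Fin l → Fin n → ℝ) :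
    stdSymplecticForm (x, ∑ i, ξ i) (y, ∑ i, ζ i) =
      ∑ i, stdSymplecticForm (x, ξ i) (y, ζ i) := by
  simp only [stdSymplecticForm, Finset.sum_apply, Finset.sum_mul, Finset.sum_sub_distrib]
  congr 1 <;> exact Finset.sum_comm

/-- Under transversality, a vector orthogonal to the conflict sum lies in the conflict sum. -/
lemma exists_fibre_decomposition {n l : ℕ}
    (L : Fin l → Submodule ℝ ((Fin n → ℝ) × (Fin n → ℝ)))
    (hL : ∀ i, IsLagrangian (stdSymplecticForm (n := n)) (L i))
    (htrans : ∀ z : Fin l → (Fin n → ℝ) × (Fin n → ℝ),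
      ∃ p : Fin l → (Fin n → ℝ) × (Fin n → ℝ), (∀ i, p i ∈ L i) ∧
        ∃ (x : Fin n → ℝ) (ξ : Fin l → (Fin n → ℝ)), z = p + fun i => (x, ξ i))
    (v : (Fin n → ℝ) × (Fin n → ℝ))
    (hv : ∀ (x : Fin n → ℝ) (ξ : Fin l → Fin n → ℝ), (∀ i, (x, ξ i) ∈ L i) →
      stdSymplecticForm v (x, ∑ i, ξ i) = 0) :
    ∃ a : Fin l → Fin n → ℝ, (∀ i, (v.1, a i) ∈ L i) ∧ ∑ i, a i = v.2 := by
  let P := Submodule.pi Set.univ L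
  obtain ⟨f, hf⟩ := exists_functional_comp_eq (P.subtype.coprod (conormalDiagonal n l))
    (fun z => by
      obtain ⟨p, hp, x, ξ, rfl⟩ := htrans z
      exact ⟨(⟨p, fun i _ => hp i⟩, (x, ξ)), rfl⟩)
    (conflictPairing n l v ∘ₗ LinearMap.snd ℝ P _)
    (fun u hu => hv _ _ fun i => by
      have h : u.1.1 i + (u.2.1, u.2.2 i) = 0 := congrFun hu i
      refine (neg_eq_of_add_eq_zero_right h) ▸ (L i).neg_mem (u.1.2 i trivial))
  have hfP : ∀ p : Fin l → (Fin n → ℝ) × (Fin n → ℝ), (∀ i, p i ∈ L i) → f p = 0 := by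
    intro p hp
    have h := hf (⟨p, fun i _ => hp i⟩, 0)
    simpa using h
  have hfD : ∀ (x : Fin n → ℝ) (ξ : Fin l → Fin n → ℝ),
      f (fun i => (x, ξ i)) = stdSymplecticForm v (x, ∑ i, ξ i) := by
    intro x ξ
    have h := hf (0, (x, ξ))
    simp only [LinearMap.coprod_apply, map_zero, zero_add] at h
    exact h
  let a : Fin l → Fin n → ℝ := fun i j => f (Pi.single i (Pi.single j 1, 0))
  refine ⟨a, fun i => (hL i _).2 fun w hw => ?_, ?_⟩
  · have h₀ : f (Pi.single i w) = 0 := hfP _ fun k => by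
      rcases eq_or_ne k i with rfl | hk
      · simpa using hw
      · simp [hk]
    have hbase : f (Pi.single i (w.1, 0)) = ∑ j, a i j * w.1 j := by
      let g : (Fin n → ℝ) →ₗ[ℝ] ℝ := f ∘ₗ LinearMap.single ℝ _ i ∘ₗ LinearMap.inl ℝ _ _
      have h := g.pi_apply_eq_sum_univ w.1
      simp only [smul_eq_mul] at h
      refine h.trans (Finset.sum_congr rfl fun j _ => ?_)
      have hj : (fun k => if j = k then (1 : ℝ) else 0) = Pi.single j 1 := by
        funext k
        simp [Pi.single_apply, eq_comm]
      rw [hj, mul_comm]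
      rfl
    have hfibre : f (Pi.single i (0, w.2)) = -∑ j, w.2 j * v.1 j := by
      have h := hfD 0 (Pi.single i w.2)
      have hs : (fun k => ((0 : Fin n → ℝ), (Pi.single i w.2 : Fin l → Fin n → ℝ) k)) =
          Pi.single i (0, w.2) := by
        funext k
        rcases eq_or_ne k i with rfl | hk
        · simp
        · simp [hk]
      rw [hs, Finset.sum_pi_single'] at h
      simpa [stdSymplecticForm] using h
    have hw' : Pi.single i w = (Pi.single i (w.1, 0) + Pi.single i (0, w.2) :
        Fin l → (Fin n → ℝ) × (Fin n → ℝ)) := by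
      rw [← Pi.single_add]
      simp
    rw [hw', map_add, hbase, hfibre] at h₀
    simpa [stdSymplecticForm, sub_eq_add_neg] using h₀
  · funext j
    have h := hfD (Pi.single j 1) 0
    have hs : (fun i => ((Pi.single j 1 : Fin n → ℝ), (0 : Fin l → Fin n → ℝ) i)) =
        ∑ i, Pi.single i (Pi.single j 1, 0) :=
      (Finset.univ_sum_single _).symm
    rw [hs, map_sum] at h
    simpa [stdSymplecticForm, a, Finset.sum_apply, Pi.single_apply] using h

/-- Linear version of the theorem that the lifted conflict set is Lagrangian: if the
Lagrangian subspaces `L₁, …, L_l` of `(ℝⁿ × ℝⁿ, ω₀)` are such that `L₁ × ⋯ × L_l` is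
transverse to the conormal-to-the-diagonal subspace
`D = {((x, ξ₁), …, (x, ξ_l))}`, then
`{(x, ξ₁ + ⋯ + ξ_l) : (x, ξᵢ) ∈ Lᵢ for all i}` is a Lagrangian subspace of
`(ℝⁿ × ℝⁿ, ω₀)`. -/
theorem conflict_sum_isLagrangian (n l : ℕ)
    (L : Fin l → Submodule ℝ ((Fin n → ℝ) × (Fin n → ℝ)))
    (hL : ∀ i, IsLagrangian (stdSymplecticForm (n := n)) (L i))
    (htrans : ∀ z : Fin l → (Fin n → ℝ) × (Fin n → ℝ),
      ∃ p : Fin l → (Fin n → ℝ) × (Fin n → ℝ), (∀ i, p i ∈ L i) ∧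
        ∃ (x : Fin n → ℝ) (ξ : Fin l → (Fin n → ℝ)),
          z = p + fun i => (x, ξ i)) :
    IsLagrangianSet (stdSymplecticForm (n := n))
      {q : (Fin n → ℝ) × (Fin n → ℝ) |
        ∃ (x : Fin n → ℝ) (ξ : Fin l → (Fin n → ℝ)),
          (∀ i, (x, ξ i) ∈ L i) ∧ q = (x, ∑ i, ξ i)} := by
  refine ⟨⟨{ carrier := _, add_mem' := ?_, zero_mem' := ?_, smul_mem' := ?_ }, rfl⟩, fun v => ?_⟩
  · rintro _ _ ⟨x, ξ, h, rfl⟩ ⟨y, ζ, k, rfl⟩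
    exact ⟨x + y, ξ + ζ, fun i => (L i).add_mem (h i) (k i), by
      simp [Finset.sum_add_distrib]⟩
  · exact ⟨0, 0, fun i => (L i).zero_mem, by simp; rfl⟩
  · rintro c _ ⟨x, ξ, h, rfl⟩
    exact ⟨c • x, c • ξ, fun i => (L i).smul_mem c (h i), by simp [Finset.smul_sum]⟩
  constructor
  · rintro ⟨x, ξ, h, rfl⟩ _ ⟨y, ζ, k, rfl⟩
    rw [stdSymplecticForm_sum]
    exact Finset.sum_eq_zero fun i _ => (hL i _).1 (h i) _ (k i)
  · intro hv
    obtain ⟨a, ha, hsum⟩ := exists_fibre_decomposition L hL htrans v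
      fun x ξ h => hv _ ⟨x, ξ, h, rfl⟩
    exact ⟨v.1, a, ha, by rw [hsum]⟩
end

section
/- Let L₁ and L₂ be Lagrangian subspaces of ℝⁿ × ℝⁿ with the standard symplectic form ω₀((x, ξ), (x', ξ')) = ⟨ξ, x'⟩ − ⟨ξ', x⟩. Let D* = {((x₁, ξ), (x₂, ξ)) : x₁, x₂ ∈ ℝⁿ, ξ ∈ ℝⁿ} ⊆ (ℝⁿ × ℝⁿ)² be the diagonal-in-the-fiber subspace. If L₁ × L₂ + D* = (ℝⁿ × ℝⁿ)², then the subspace L = {((x₁ + x₂)/2, 2ξ) : (x₁, ξ) ∈ L₁ and (x₂, ξ) ∈ L₂} is a Lagrangian subspace of (ℝⁿ × ℝⁿ, ω₀). -/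
/-- The form `ω₀` in terms of dot products. -/
lemma stdSymplecticForm_eq_dotProduct {n : ℕ} (p q : (Fin n → ℝ) × (Fin n → ℝ)) :
    stdSymplecticForm p q = p.2 ⬝ᵥ q.1 - q.2 ⬝ᵥ p.1 := rfl

/-- A linear functional vanishing on the kernel of a linear map `d` to `ℝⁿ` is the dot product
of `d` with a fixed vector. -/
lemma exists_dotProduct_eq_of_ker_le_ker {E : Type*} [AddCommGroup E] [Module ℝ E] {n : ℕ}
    (d : E →ₗ[ℝ] (Fin n → ℝ)) (φ : E →ₗ[ℝ] ℝ) (h : LinearMap.ker d ≤ LinearMap.ker φ) :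
    ∃ c : Fin n → ℝ, ∀ x, φ x = c ⬝ᵥ d x := by
  have hmem : φ ∈ Submodule.span ℝ (Set.range fun i => LinearMap.proj i ∘ₗ d) := by
    refine mem_span_of_iInf_ker_le_ker fun x hx => h ?_
    simp only [Submodule.mem_iInf, LinearMap.mem_ker] at hx ⊢
    exact funext hx
  obtain ⟨c, rfl⟩ := (Submodule.mem_span_range_iff_exists_fun ℝ).1 hmem
  exact ⟨c, fun x => by simp [dotProduct]⟩

/-- Linear version of the theorem that the center set is Lagrangian: if the Lagrangian
subspaces `L₁, L₂` of `(ℝⁿ × ℝⁿ, ω₀)` are such that `L₁ × L₂` is transverse to the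
diagonal-in-the-fiber subspace `D* = {((x₁, ξ), (x₂, ξ))}`, then
`{((x₁ + x₂)/2, 2ξ) : (x₁, ξ) ∈ L₁, (x₂, ξ) ∈ L₂}` is a Lagrangian subspace of
`(ℝⁿ × ℝⁿ, ω₀)`. -/
theorem center_set_isLagrangian (n : ℕ)
    (L₁ L₂ : Submodule ℝ ((Fin n → ℝ) × (Fin n → ℝ)))
    (hL₁ : IsLagrangian (stdSymplecticForm (n := n)) L₁)
    (hL₂ : IsLagrangian (stdSymplecticForm (n := n)) L₂)
    (htrans : ∀ z : ((Fin n → ℝ) × (Fin n → ℝ)) × ((Fin n → ℝ) × (Fin n → ℝ)),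
      ∃ p₁ ∈ L₁, ∃ p₂ ∈ L₂, ∃ (x₁ x₂ ξ : Fin n → ℝ),
        z = (p₁, p₂) + ((x₁, ξ), (x₂, ξ))) :
    IsLagrangianSet (stdSymplecticForm (n := n))
      {q : (Fin n → ℝ) × (Fin n → ℝ) |
        ∃ (x₁ x₂ ξ : Fin n → ℝ), (x₁, ξ) ∈ L₁ ∧ (x₂, ξ) ∈ L₂ ∧
          q = ((1 / 2 : ℝ) • (x₁ + x₂), (2 : ℝ) • ξ)} := by
  simp only [IsLagrangian, stdSymplecticForm_eq_dotProduct] at hL₁ hL₂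
  refine ⟨⟨{ carrier := _, add_mem' := ?_, zero_mem' := ?_, smul_mem' := ?_ }, rfl⟩, ?_⟩
  · rintro _ _ ⟨x₁, x₂, ξ, h₁, h₂, rfl⟩ ⟨y₁, y₂, η, k₁, k₂, rfl⟩
    refine ⟨x₁ + y₁, x₂ + y₂, ξ + η, L₁.add_mem h₁ k₁, L₂.add_mem h₂ k₂, ?_⟩
    ext i <;> simp <;> ring
  · exact ⟨0, 0, 0, L₁.zero_mem, L₂.zero_mem, by ext <;> simp⟩
  · rintro r _ ⟨x₁, x₂, ξ, h₁, h₂, rfl⟩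
    refine ⟨r • x₁, r • x₂, r • ξ, L₁.smul_mem r h₁, L₂.smul_mem r h₂, ?_⟩
    ext i <;> simp <;> ring
  rintro ⟨a, b⟩
  simp only [stdSymplecticForm_eq_dotProduct, Set.mem_ofPred_eq]
  constructor
  · rintro ⟨x₁, x₂, ξ, h₁, h₂, h⟩ _ ⟨y₁, y₂, η, k₁, k₂, rfl⟩
    have e₁ := (hL₁ _).1 h₁ _ k₁
    have e₂ := (hL₂ _).1 h₂ _ k₂
    obtain ⟨rfl, rfl⟩ := Prod.mk.inj h
    simp only [dotProduct_smul, smul_dotProduct, dotProduct_add, smul_eq_mul] at e₁ e₂ ⊢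
    linarith
  · intro h
    let d : (L₁ × L₂) →ₗ[ℝ] (Fin n → ℝ) :=
      { toFun := fun p => p.1.1.2 - p.2.1.2
        map_add' := fun p q => by ext i; simp; ring
        map_smul' := fun r p => by ext i; simp; ring }
    let φ : (L₁ × L₂) →ₗ[ℝ] ℝ :=
      { toFun := fun p => (1 / 2 : ℝ) * (b ⬝ᵥ (p.1.1.1 + p.2.1.1)) - 2 * (p.1.1.2 ⬝ᵥ a)
        map_add' := fun p q => by simp [dotProduct_add, add_dotProduct]; ring
        map_smul' := fun r p => by simp [dotProduct_add, smul_dotProduct]; ring }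
    have hker : LinearMap.ker d ≤ LinearMap.ker φ := by
      rintro ⟨⟨⟨y₁, η₁⟩, k₁⟩, ⟨⟨y₂, η₂⟩, k₂⟩⟩ hp
      obtain rfl : η₁ = η₂ := sub_eq_zero.1 hp
      simpa [φ, mul_add] using h _ ⟨y₁, y₂, η₁, k₁, k₂, rfl⟩
    obtain ⟨c, hc⟩ := exists_dotProduct_eq_of_ker_le_ker d φ hker
    refine ⟨(2 : ℝ) • a + c, -c, (1 / 2 : ℝ) • b, ?_, ?_, ?_⟩
    · refine (hL₁ _).2 fun w hw => ?_
      have := hc (⟨w, hw⟩, 0)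
      simp [φ, d] at this
      simp [dotProduct_add, dotProduct_comm w.2 c]
      linarith
    · refine (hL₂ _).2 fun w hw => ?_
      have := hc (0, ⟨w, hw⟩)
      simp [φ, d] at this
      simp [dotProduct_comm w.2 c]
      linarith
    · ext i <;> simp
end
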